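/- arXiv:1711.03193 — 2 statements merged into one kernel-verified Lean document; each statement's English description precedes it below -/
import Mathlib

section
/- Let n ≥ 1 and 0 < φ < π/2. Then Θ(φ) > (sin φ)^n / sqrt(2π(n+1)), where Θ(φ) is the normalized measure of a spherical cap of angular radius φ on the n-dimensional unit sphere. -/
open MeasureTheory

/-- The spherical cap on the unit sphere in `ℝ^{n+1}` with center `x` and angular
radius `ψ`: the set of points `y` of the unit sphere whose angle with `x` at the origin
is at most `ψ`. -/
noncomputable def sphericalCap (n : ℕ) (x : EuclideanSpace ℝ (Fin (n + 1))) (ψ : ℝ) :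
    Set (EuclideanSpace ℝ (Fin (n + 1))) :=
  {y | y ∈ Metric.sphere (0 : EuclideanSpace ℝ (Fin (n + 1))) 1 ∧
    InnerProductGeometry.angle x y ≤ ψ}

lemma capaux_int (n : ℕ) (hn : 1 ≤ n) (c : ℝ) (hc0 : 0 < c) (hc1 : c < 1) :
    Real.sqrt (1 - c ^ 2) ^ n * (1 - c) < (n + 1) * ∫ t in c..1, Real.sqrt (1 - t ^ 2) ^ n := by
  have hn0 : (0 : ℝ) < n := by exact_mod_cast hn
  have hcont : ContinuousOn (fun t : ℝ => -(Real.sqrt (1 - t ^ 2) ^ n * (1 + n * t / (1 + t))))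
      (Set.uIcc c 1) := by
    rw [Set.uIcc_of_le hc1.le]
    refine ContinuousOn.neg (ContinuousOn.mul (by fun_prop) ?_)
    refine ContinuousOn.add (by fun_prop) (ContinuousOn.div (by fun_prop) (by fun_prop) ?_)
    intro t ht; have := ht.1; linarith
  have hcont2 : ContinuousOn (fun t : ℝ => Real.sqrt (1 - t ^ 2) ^ n * (n / (1 + t)))
      (Set.uIcc c 1) := by
    rw [Set.uIcc_of_le hc1.le]
    refine ContinuousOn.mul (by fun_prop) (ContinuousOn.div (by fun_prop) (by fun_prop) ?_)
    intro t ht; have := ht.1; linarith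
  have h1 := intervalIntegral.integral_eq_sub_of_hasDerivAt_of_le hc1.le
    (f := fun t : ℝ => Real.sqrt (1 - t ^ 2) ^ n * (1 - t))
    (f' := fun t : ℝ => -(Real.sqrt (1 - t ^ 2) ^ n * (1 + n * t / (1 + t))))
    (by fun_prop) (by
      intro t ht
      have hpos : 0 < 1 - t ^ 2 := by nlinarith [ht.1, ht.2]
      have hs : 0 < Real.sqrt (1 - t ^ 2) := Real.sqrt_pos.2 hpos
      have hsq : Real.sqrt (1 - t ^ 2) ^ 2 = 1 - t ^ 2 := Real.sq_sqrt hpos.le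
      have hd : HasDerivAt (fun t : ℝ => 1 - t ^ 2) (-(2 * t)) t := by
        simpa using ((hasDerivAt_id t).pow 2).const_sub 1
      have hd2 := ((hd.sqrt hpos.ne').pow n).mul ((hasDerivAt_id t).const_sub 1)
      refine HasDerivAt.congr_deriv (f := fun t : ℝ => Real.sqrt (1 - t ^ 2) ^ n * (1 - t)) hd2 ?_
      obtain ⟨m, rfl⟩ : ∃ m, n = m + 1 := ⟨n - 1, by omega⟩
      have h1t : (1 + t) ≠ 0 := by have := ht.1; linarith
      simp only [Nat.add_sub_cancel, Pi.pow_apply, id]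
      generalize Real.sqrt (1 - t ^ 2) = w at *
      field_simp
      linear_combination ((m + 1 : ℕ) : ℝ) * w ^ m * t * hsq)
    hcont.intervalIntegrable
  have h2 := intervalIntegral.intervalIntegral_pos_of_pos_on hcont2.intervalIntegrable (by
      intro t ht
      have hpos : 0 < 1 - t ^ 2 := by nlinarith [ht.1, ht.2]
      have hs : 0 < Real.sqrt (1 - t ^ 2) := Real.sqrt_pos.2 hpos
      have h1t : 0 < (1 + t) := by have := ht.1; linarith
      positivity) hc1
  have h3 : (n + 1) * ∫ t in c..1, Real.sqrt (1 - t ^ 2) ^ n =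
      (∫ t in c..1, Real.sqrt (1 - t ^ 2) ^ n * (n / (1 + t))) -
      ∫ t in c..1, -(Real.sqrt (1 - t ^ 2) ^ n * (1 + n * t / (1 + t))) := by
    rw [← intervalIntegral.integral_sub hcont2.intervalIntegrable hcont.intervalIntegrable,
      ← intervalIntegral.integral_const_mul]
    apply intervalIntegral.integral_congr
    intro t ht
    rw [Set.uIcc_of_le hc1.le] at ht
    have h1t : (1 + t) ≠ 0 := by have := ht.1; linarith
    simp only
    field_simp
    ring
  rw [h3, h1]
  simp
  linarith

lemma capaux_int2 (n : ℕ) (hn : 1 ≤ n) (c s : ℝ) (hc0 : 0 < c) (hc1 : c < 1) (hs : 0 < s)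
    (hcs : s ^ 2 + c ^ 2 = 1) :
    s ^ n < (n + 1) * ∫ t in (0 : ℝ)..1, (min (t * s / c) (Real.sqrt (1 - t ^ 2))) ^ n := by
  have hcont : Continuous (fun t : ℝ => (min (t * s / c) (Real.sqrt (1 - t ^ 2))) ^ n) := by
    fun_prop
  rw [← intervalIntegral.integral_add_adjacent_intervals (b := c)
    (hcont.intervalIntegrable _ _) (hcont.intervalIntegrable _ _)]
  have hsc : Real.sqrt (1 - c ^ 2) = s := by
    rw [← hcs]; simp [hs.le]
  have e1 : ∫ t in (0 : ℝ)..c, (min (t * s / c) (Real.sqrt (1 - t ^ 2))) ^ n =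
      ∫ t in (0 : ℝ)..c, (s / c) ^ n * t ^ n := by
    apply intervalIntegral.integral_congr
    intro t ht
    rw [Set.uIcc_of_le hc0.le] at ht
    simp only
    rw [min_eq_left, ← mul_pow]
    · congr 1; ring
    · apply Real.le_sqrt_of_sq_le
      have h1 : t * s / c ≤ s := by
        rw [div_le_iff₀ hc0]; nlinarith [ht.2]
      have h0 : 0 ≤ t * s / c := by have := ht.1; positivity
      nlinarith [ht.1, ht.2]
  have e2 : ∫ t in c..1, (min (t * s / c) (Real.sqrt (1 - t ^ 2))) ^ n =
      ∫ t in c..1, Real.sqrt (1 - t ^ 2) ^ n := by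
    apply intervalIntegral.integral_congr
    intro t ht
    rw [Set.uIcc_of_le hc1.le] at ht
    simp only
    rw [min_eq_right]
    have h1 : s ≤ t * s / c := by
      rw [le_div_iff₀ hc0]; nlinarith [ht.1]
    refine le_trans ?_ h1
    rw [← hsc]
    apply Real.sqrt_le_sqrt
    nlinarith [ht.1]
  rw [e1, e2, mul_add, intervalIntegral.integral_const_mul, integral_pow]
  have := capaux_int n hn c hc0 hc1
  rw [hsc] at this
  have e3 : ((n : ℝ) + 1) * ((s / c) ^ n * ((c ^ (n + 1) - 0 ^ (n + 1)) / (n + 1))) = s ^ n * c := by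
    rw [div_pow]; simp; field_simp; ring
  rw [e3]; linarith

lemma capaux_gamma (n : ℕ) (hn : 1 ≤ n) :
    1 / Real.sqrt (2 * Real.pi * (n + 1)) * ((n + 1) *
     (√Real.pi ^ (n + 1) / Real.Gamma (((n + 1 : ℕ) : ℝ) / 2 + 1)))
      ≤ (√Real.pi ^ n / Real.Gamma ((n : ℝ) / 2 + 1)) := by
  have hx : (0 : ℝ) < ((n : ℝ) + 1) / 2 := by positivity
  have hg := Real.Gamma_mul_add_mul_le_rpow_Gamma_mul_rpow_Gamma hx
    (show (0 : ℝ) < ((n : ℝ) + 1) / 2 + 1 by positivity) (a := 1 / 2) (b := 1 / 2)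
    (by norm_num) (by norm_num) (by norm_num)
  have e : (1 / 2 : ℝ) * (((n : ℝ) + 1) / 2) + 1 / 2 * (((n : ℝ) + 1) / 2 + 1) = n / 2 + 1 := by
    ring
  have hG := Real.Gamma_pos_of_pos hx
  rw [e, Real.Gamma_add_one hx.ne', ← Real.sqrt_eq_rpow, ← Real.sqrt_eq_rpow,
    Real.sqrt_mul hx.le, mul_comm, mul_assoc, Real.mul_self_sqrt hG.le] at hg
  push_cast
  rw [Real.Gamma_add_one hx.ne']
  have hG2 : 0 < Real.Gamma ((n : ℝ) / 2 + 1) := Real.Gamma_pos_of_pos (by positivity)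
  have e2 : 2 * Real.pi * ((n : ℝ) + 1) = Real.pi * (((n : ℝ) + 1) / 2) * 2 ^ 2 := by ring
  have hpi : 0 < √Real.pi := Real.sqrt_pos.2 Real.pi_pos
  have hsx : 0 < √(((n : ℝ) + 1) / 2) := Real.sqrt_pos.2 hx
  rw [e2, Real.sqrt_mul (by positivity), Real.sqrt_sq (by norm_num), Real.sqrt_mul Real.pi_pos.le]
  have e3 : 1 / (√Real.pi * √(((n : ℝ) + 1) / 2) * 2) * (((n : ℝ) + 1) * (√Real.pi ^ (n + 1) /
     (((n : ℝ) + 1) / 2 * Real.Gamma (((n : ℝ) + 1) / 2)))) =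
     √Real.pi ^ n / (√(((n : ℝ) + 1) / 2) * Real.Gamma (((n : ℝ) + 1) / 2)) := by
    field_simp
    ring
  rw [e3]
  exact div_le_div_of_nonneg_left (by positivity) hG2 hg

lemma capaux_slice (n : ℕ) (S : Set (EuclideanSpace ℝ (Fin (n + 1)))) (hS : MeasurableSet S) :
    volume S = ∫⁻ t : ℝ, volume {z : EuclideanSpace ℝ (Fin n) |
      WithLp.toLp 2 (Fin.cons t z.ofLp : Fin (n + 1) → ℝ) ∈ S} := by
  have h1 := (PiLp.volume_preserving_ofLp (Fin n))
  have h2 := (MeasurePreserving.id (volume : Measure ℝ)).prod h1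
  have h3 := (volume_preserving_piFinSuccAbove (fun _ : Fin (n + 1) => ℝ) 0).symm
  have h4 := (PiLp.volume_preserving_toLp (Fin (n + 1))).comp (h3.comp h2)
  rw [← h4.measure_preimage hS.nullMeasurableSet, Measure.prod_apply (h4.measurable hS)]
  refine lintegral_congr fun t => ?_
  congr 1
  ext z
  have : (MeasurableEquiv.piFinSuccAbove (fun _ : Fin (n + 1) => ℝ) 0).symm (t, z.ofLp) =
      (Fin.cons t z.ofLp : Fin (n + 1) → ℝ) := by
    simp [MeasurableEquiv.piFinSuccAbove, Fin.insertNthEquiv]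
  simp only [Set.mem_preimage, Function.comp_apply, Prod.map_apply, id, Set.mem_ofPred_eq]
  rw [this]

lemma capaux_vol (n : ℕ) (hn : 1 ≤ n) (c s : ℝ) (hc0 : 0 < c) (hc1 : c < 1) (hs : 0 < s)
    (hcs : s ^ 2 + c ^ 2 = 1) :
    ENNReal.ofReal (∫ t in (0 : ℝ)..1, (min (t * s / c) (Real.sqrt (1 - t ^ 2))) ^ n) *
      volume (Metric.ball (0 : EuclideanSpace ℝ (Fin n)) 1) ≤
    volume (Metric.ball (0 : EuclideanSpace ℝ (Fin (n + 1))) 1 ∩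
      {y | c * ‖y‖ ≤ y 0}) := by
  have hcont : Continuous (fun t : ℝ => (min (t * s / c) (Real.sqrt (1 - t ^ 2))) ^ n) := by
    fun_prop
  have : Nonempty (Fin n) := ⟨⟨0, hn⟩⟩
  rw [capaux_slice, intervalIntegral.integral_of_le zero_le_one,
    ofReal_integral_eq_lintegral_ofReal]
  rotate_left
  · exact (hcont.integrableOn_Icc (a := 0) (b := 1)).mono_set Set.Ioc_subset_Icc_self
  · refine (ae_restrict_iff' measurableSet_Ioc).2 (Filter.Eventually.of_forall fun t ht => ?_)
    have := ht.1
    simp only [Pi.zero_apply]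
    positivity
  · refine measurableSet_ball.inter (IsClosed.measurableSet ?_)
    exact isClosed_le (by fun_prop) (by fun_prop)
  rw [← lintegral_mul_const _ (by fun_prop)]
  refine le_trans ?_ (setLIntegral_le_lintegral (Set.Ioc 0 1) _)
  refine setLIntegral_mono' measurableSet_Ioc fun t ht => ?_
  have h0 : 0 < t := ht.1
  have hr : 0 ≤ min (t * s / c) (Real.sqrt (1 - t ^ 2)) := by positivity
  have hb := Measure.addHaar_ball (volume : Measure (EuclideanSpace ℝ (Fin n))) 0 hr
  rw [finrank_euclideanSpace_fin] at hb
  rw [← hb]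
  refine measure_mono fun z hz => ?_
  rw [mem_ball_zero_iff, lt_min_iff] at hz
  obtain ⟨hz1, hz2⟩ := hz
  have hnorm : ‖(WithLp.toLp 2 (Fin.cons t z.ofLp : Fin (n + 1) → ℝ))‖ ^ 2 = t ^ 2 + ‖z‖ ^ 2 := by
    rw [EuclideanSpace.norm_sq_eq, EuclideanSpace.norm_sq_eq, Fin.sum_univ_succ]
    simp
  rw [Real.lt_sqrt (norm_nonneg _)] at hz2
  refine ⟨?_, ?_⟩
  · rw [mem_ball_zero_iff]
    refine lt_of_pow_lt_pow_left₀ 2 zero_le_one ?_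
    rw [hnorm]; linarith
  · show c * _ ≤ t
    refine le_of_sq_le_sq ?_ h0.le
    rw [mul_pow, hnorm]
    rw [lt_div_iff₀ hc0] at hz1
    have : (‖z‖ * c) ^ 2 ≤ (t * s) ^ 2 := by
      have := norm_nonneg z
      gcongr
    have : t ^ 2 = t ^ 2 * (s ^ 2 + c ^ 2) := by rw [hcs, mul_one]
    nlinarith

lemma capaux_tonelli (n : ℕ) (c : ℝ) 
    (μ : Measure (EuclideanSpace ℝ (Fin (n + 1)))) [IsProbabilityMeasure μ]
    (hsph : μ (Metric.sphere (0 : EuclideanSpace ℝ (Fin (n + 1))) 1) = 1)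
    (hinv : ∀ A : EuclideanSpace ℝ (Fin (n + 1)) ≃ₗᵢ[ℝ] EuclideanSpace ℝ (Fin (n + 1)),
      ∀ s : Set (EuclideanSpace ℝ (Fin (n + 1))), MeasurableSet s → μ (⇑A ⁻¹' s) = μ s)
    (x : EuclideanSpace ℝ (Fin (n + 1))) (hx : ‖x‖ = 1) :
    volume (Metric.ball (0 : EuclideanSpace ℝ (Fin (n + 1))) 1 ∩ {y | c * ‖y‖ ≤ y 0}) =
    μ {y | c * ‖y‖ ≤ inner ℝ y x} * volume (Metric.ball (0 : EuclideanSpace ℝ (Fin (n + 1))) 1) := by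
  let T : Set ((EuclideanSpace ℝ (Fin (n + 1))) × (EuclideanSpace ℝ (Fin (n + 1)))) := {p | c * ‖p.1‖ * ‖p.2‖ ≤ inner ℝ p.1 p.2}
  have hT : MeasurableSet T := by
    refine IsClosed.measurableSet (isClosed_le ?_ ?_) <;> fun_prop
  let ν : Measure (EuclideanSpace ℝ (Fin (n + 1))) := volume.restrict (Metric.ball 0 1)
  have hsw := (Measure.prod_apply (μ := μ) (ν := ν) hT).symm.trans
    (Measure.prod_apply_symm (μ := μ) (ν := ν) hT)
  have hae : ∀ᵐ a ∂μ, a ∈ Metric.sphere (0 : (EuclideanSpace ℝ (Fin (n + 1)))) 1 := by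
    rw [ae_iff]
    have := prob_compl_eq_zero_iff (μ := μ) (s := Metric.sphere (0 : (EuclideanSpace ℝ (Fin (n + 1)))) 1)
      Metric.isClosed_sphere.measurableSet
    exact this.2 hsph
  have hL : ∫⁻ a, ν (Prod.mk a ⁻¹' T) ∂μ =
      volume (Metric.ball (0 : (EuclideanSpace ℝ (Fin (n + 1)))) 1 ∩ {y | c * ‖y‖ ≤ y 0}) := by
    rw [lintegral_congr_ae (g := fun _ =>
      volume (Metric.ball (0 : (EuclideanSpace ℝ (Fin (n + 1)))) 1 ∩ {y | c * ‖y‖ ≤ y 0}))]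
    · simp
    filter_upwards [hae] with a ha
    replace ha : ‖a‖ = 1 := by simpa using ha
    let e : (EuclideanSpace ℝ (Fin (n + 1))) := EuclideanSpace.single 0 1
    have he : ‖a‖ = ‖e‖ := by simp [ha, e]
    let A := (ℝ ∙ (a - e))ᗮ.reflection
    have hA : A a = e := Submodule.reflection_sub he
    rw [Measure.restrict_apply (measurable_prodMk_left hT)]
    have hm : MeasurableSet (Metric.ball (0 : (EuclideanSpace ℝ (Fin (n + 1)))) 1 ∩ {y | c * ‖y‖ ≤ y 0}) :=
      measurableSet_ball.inter (IsClosed.measurableSet (isClosed_le (by fun_prop) (by fun_prop)))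
    rw [← A.measurePreserving.measure_preimage hm.nullMeasurableSet]
    congr 1
    ext y
    have h0 : (A y) 0 = inner ℝ a y := by
      rw [← A.inner_map_map, hA]; simp [e, EuclideanSpace.inner_single_left]
    simp [T, ha, h0, and_comm]
  have hR : ∫⁻ y, μ ((fun a => (a, y)) ⁻¹' T) ∂ν =
      μ {y | c * ‖y‖ ≤ inner ℝ y x} * volume (Metric.ball (0 : (EuclideanSpace ℝ (Fin (n + 1)))) 1) := by
    rw [lintegral_congr_ae (g := fun _ => μ {y | c * ‖y‖ ≤ inner ℝ y x})]
    · simp [ν]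
    have h0 : ∀ᵐ y ∂ν, y ≠ 0 := ae_restrict_of_ae (Measure.ae_ne volume 0)
    filter_upwards [h0] with y hy
    have hy' : 0 < ‖y‖ := norm_pos_iff.2 hy
    have he : ‖y‖ = ‖‖y‖ • x‖ := by simp [norm_smul, hx]
    let A := (ℝ ∙ (y - ‖y‖ • x))ᗮ.reflection
    have hA : A y = ‖y‖ • x := Submodule.reflection_sub he
    rw [← hinv A _ (IsClosed.measurableSet (isClosed_le (by fun_prop) (by fun_prop)))]
    congr 1
    ext a
    have h1 : inner ℝ a y = ‖y‖ * inner ℝ (A a) x := by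
      rw [← A.inner_map_map, hA, inner_smul_right]
    simp only [T, Set.mem_preimage, Set.mem_ofPred_eq, h1, LinearIsometryEquiv.norm_map]
    rw [mul_comm _ ‖y‖, mul_le_mul_iff_right₀ hy']
  rw [← hL, ← hR, hsw]

/-- Böröczky–Wintsche: for the rotation-invariant probability measure `μ` on the unit
sphere `S^n` (`n ≥ 1`) and `0 < φ < π/2`, the normalized measure `Θ(φ)` of a cap of
angular radius `φ` satisfies `Θ(φ) > sin^n φ / sqrt(2π(n+1))`. -/
theorem cap_measure_lower (n : ℕ) (hn : 1 ≤ n) (φ : ℝ)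
    (hφ0 : 0 < φ) (hφ : φ < Real.pi / 2)
    (μ : Measure (EuclideanSpace ℝ (Fin (n + 1)))) [IsProbabilityMeasure μ]
    (hsph : μ (Metric.sphere (0 : EuclideanSpace ℝ (Fin (n + 1))) 1) = 1)
    (hinv : ∀ A : EuclideanSpace ℝ (Fin (n + 1)) ≃ₗᵢ[ℝ] EuclideanSpace ℝ (Fin (n + 1)),
      ∀ s : Set (EuclideanSpace ℝ (Fin (n + 1))), MeasurableSet s → μ (⇑A ⁻¹' s) = μ s)
    (x : EuclideanSpace ℝ (Fin (n + 1)))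
    (hx : x ∈ Metric.sphere (0 : EuclideanSpace ℝ (Fin (n + 1))) 1) :
    Real.sin φ ^ n / Real.sqrt (2 * Real.pi * (n + 1)) < (μ (sphericalCap n x φ)).toReal := by
  unfold sphericalCap
  have hs : 0 < Real.sin φ := Real.sin_pos_of_pos_of_lt_pi hφ0 (by linarith [Real.pi_pos])
  have hc : 0 < Real.cos φ := Real.cos_pos_of_mem_Ioo ⟨by linarith [Real.pi_pos], hφ⟩
  have hcs := Real.sin_sq_add_cos_sq φ
  have hc1 : Real.cos φ < 1 := by nlinarith
  have hx1 : ‖x‖ = 1 := by simpa using hx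
  have hae : ∀ᵐ a ∂μ, a ∈ Metric.sphere (0 : EuclideanSpace ℝ (Fin (n + 1))) 1 := by
    rw [ae_iff]
    exact (prob_compl_eq_zero_iff (μ := μ) Metric.isClosed_sphere.measurableSet).2 hsph
  have hcap : μ ({y | y ∈ Metric.sphere (0 : EuclideanSpace ℝ (Fin (n + 1))) 1 ∧
    InnerProductGeometry.angle x y ≤ φ}) = μ {y | Real.cos φ * ‖y‖ ≤ inner ℝ y x} := by
    apply measure_congr
    filter_upwards [hae] with a ha
    have ha1 : ‖a‖ = 1 := by simpa using ha
    apply propext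
    show (a ∈ _ ∧ _) ↔ Real.cos φ * ‖a‖ ≤ inner ℝ a x
    simp only [ha, true_and, ha1, mul_one, real_inner_comm]
    have h1 : Real.cos (InnerProductGeometry.angle x a) = inner ℝ x a := by
      rw [InnerProductGeometry.cos_angle, hx1, ha1]; simp
    rw [← h1]
    refine (Real.strictAntiOn_cos.le_iff_ge ?_ ?_).symm
    · exact ⟨hφ0.le, by linarith [Real.pi_pos]⟩
    · exact ⟨InnerProductGeometry.angle_nonneg _ _, InnerProductGeometry.angle_le_pi _ _⟩
  rw [hcap]
  have hv := capaux_vol n hn _ _ hc hc1 hs hcs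
  rw [capaux_tonelli n _ μ hsph hinv x hx1] at hv
  have hI := capaux_int2 n hn _ _ hc hc1 hs hcs
  set I := ∫ t in (0 : ℝ)..1, (min (t * Real.sin φ / Real.cos φ) (Real.sqrt (1 - t ^ 2))) ^ n
  have : Nonempty (Fin n) := ⟨⟨0, hn⟩⟩
  rw [EuclideanSpace.volume_ball, EuclideanSpace.volume_ball] at hv
  simp only [Fintype.card_fin, ENNReal.ofReal_one, one_pow, one_mul] at hv
  have hI0 : 0 < I := by
    have : 0 < Real.sin φ ^ n := by positivity
    exact pos_of_mul_pos_right (this.trans hI) (by positivity)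
  have hG1 : 0 < Real.Gamma ((n : ℝ) / 2 + 1) := Real.Gamma_pos_of_pos (by positivity)
  have hG2 : 0 < Real.Gamma (((n + 1 : ℕ) : ℝ) / 2 + 1) := Real.Gamma_pos_of_pos (by positivity)
  have hpi : 0 < √Real.pi := Real.sqrt_pos.2 Real.pi_pos
  have hv' := ENNReal.toReal_mono (by finiteness) hv
  rw [ENNReal.toReal_mul, ENNReal.toReal_mul, ENNReal.toReal_ofReal hI0.le,
    ENNReal.toReal_ofReal (by positivity), ENNReal.toReal_ofReal (by positivity)] at hv'
  have hg := capaux_gamma n hn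
  have hW : 0 < √Real.pi ^ (n + 1) / Real.Gamma (((n + 1 : ℕ) : ℝ) / 2 + 1) := by positivity
  set W := √Real.pi ^ (n + 1) / Real.Gamma (((n + 1 : ℕ) : ℝ) / 2 + 1)
  set V := √Real.pi ^ n / Real.Gamma ((n : ℝ) / 2 + 1)
  have hQ : 0 < 1 / Real.sqrt (2 * Real.pi * (n + 1)) := by
    have := Real.pi_pos
    positivity
  rw [div_eq_mul_one_div]
  set Q := 1 / Real.sqrt (2 * Real.pi * (n + 1))
  refine lt_of_mul_lt_mul_right ?_ hW.le
  refine lt_of_lt_of_le ?_ hv'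
  calc _ = Real.sin φ ^ n * (Q * W) := by ring
    _ < ((n + 1) * I) * (Q * W) := by
      exact mul_lt_mul_of_pos_right hI (by positivity)
    _ = I * (Q * ((n + 1) * W)) := by ring
    _ ≤ I * V := by exact mul_le_mul_of_nonneg_left hg hI0.le
end

section
/- Let n ≥ 1, R > 0, 0 < λ < 1, and let x = (0, …, 0, R) be the north pole of the sphere S^n_R of radius R centered at the origin in ℝ^{n+1}. Define f_λ on the closed upper hemisphere {y ∈ S^n_R : y_{n+1} ≥ 0} by f_λ(y) = (λy₁, …, λyₙ, sqrt(R² − λ²(y₁² + … + yₙ²))). Let H be a hyperplane through the origin with dist(x, H) = R sin φ₁ for some φ₁ ∈ (0, π/2), and set α₁ = arcsin(λ sin φ₁). Then for every point a in the closed upper hemisphere lying on the closed side of H containing x, the point f_λ(a) lies on the same side of H and dist(f_λ(a), H) ≥ R sin(φ₁ − α₁). -/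
open RealInnerProductSpace

/-- The contraction map `f_λ` of the closed upper hemisphere of the sphere of radius `R`
centered at the origin of `ℝ^{n+1}`: it scales the first `n` coordinates by `λ` and moves
the point back to the sphere along the line orthogonal to the tangent hyperplane at the
north pole, i.e. `f_λ(y) = (λy₁, …, λyₙ, sqrt(R² - λ²(y₁² + … + yₙ²)))`. -/
noncomputable def fContract (n : ℕ) (R lam : ℝ) (y : EuclideanSpace ℝ (Fin (n + 1))) :
    EuclideanSpace ℝ (Fin (n + 1)) :=
  (EuclideanSpace.equiv (Fin (n + 1)) ℝ).symm fun i =>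
    if i = Fin.last n then
      Real.sqrt (R ^ 2 - lam ^ 2 * ∑ j : Fin n, y (Fin.castSucc j) ^ 2)
    else lam * y i

/-- Single-hyperplane core of Proposition 1. Let `x = (0, …, 0, R)` be the north pole of
the sphere of radius `R` in `ℝ^{n+1}`, and let `H = u^⊥` be a hyperplane through the
origin with unit normal `u` pointing to the side of `x`, at distance `R sin φ₁` from `x`
(i.e. `⟪u, x⟫ = R sin φ₁` with `0 < φ₁ < π/2`). Set `α₁ = arcsin(λ sin φ₁)`. Then for
every point `a` of the closed upper hemisphere lying on the closed side of `H`
containing `x`, the point `f_λ(a)` lies on the same side of `H` and its distance to `H`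
is at least `R sin(φ₁ - α₁)`. -/
theorem fContract_dist_to_hyperplane (n : ℕ) (hn : 1 ≤ n) (R lam : ℝ) (hR : 0 < R)
    (hlam0 : 0 < lam) (hlam1 : lam < 1)
    (u : EuclideanSpace ℝ (Fin (n + 1))) (hu : ‖u‖ = 1)
    (φ₁ : ℝ) (hφ₁0 : 0 < φ₁) (hφ₁ : φ₁ < Real.pi / 2)
    (hxH : ⟪u, EuclideanSpace.single (Fin.last n) R⟫ = R * Real.sin φ₁)
    (a : EuclideanSpace ℝ (Fin (n + 1))) (ha : ‖a‖ = R)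
    (haUpper : 0 ≤ a (Fin.last n)) (haSide : 0 ≤ ⟪u, a⟫) :
    0 ≤ ⟪u, fContract n R lam a⟫ ∧
      R * Real.sin (φ₁ - Real.arcsin (lam * Real.sin φ₁)) ≤ ⟪u, fContract n R lam a⟫ := by
  have hs0 : 0 < Real.sin φ₁ := Real.sin_pos_of_pos_of_lt_pi hφ₁0 (by linarith [Real.pi_pos])
  have hc0 : 0 < Real.cos φ₁ := Real.cos_pos_of_mem_Ioo ⟨by linarith, hφ₁⟩
  have hsc := Real.sin_sq_add_cos_sq φ₁
  have hs1 : Real.sin φ₁ ≤ 1 := Real.sin_le_one _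
  have hls : lam * Real.sin φ₁ ≤ Real.sin φ₁ := by nlinarith
  have hls0 : 0 < lam * Real.sin φ₁ := by positivity
  have hα : Real.arcsin (lam * Real.sin φ₁) ≤ φ₁ := by
    have h := Real.arcsin_le_arcsin hls
    rwa [Real.arcsin_sin (by linarith) (by linarith)] at h
  have hα0 : 0 ≤ Real.arcsin (lam * Real.sin φ₁) := Real.arcsin_nonneg.2 hls0.le
  have hsin0 : 0 ≤ Real.sin (φ₁ - Real.arcsin (lam * Real.sin φ₁)) :=
    Real.sin_nonneg_of_nonneg_of_le_pi (by linarith) (by linarith [Real.pi_pos])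
  suffices hmain : R * Real.sin (φ₁ - Real.arcsin (lam * Real.sin φ₁)) ≤
      ⟪u, fContract n R lam a⟫ from ⟨le_trans (by positivity) hmain, hmain⟩
  rw [Real.sin_sub, Real.cos_arcsin, Real.sin_arcsin (by linarith) (by linarith)]
  have hul : u (Fin.last n) = Real.sin φ₁ := by
    have h : R * u (Fin.last n) = R * Real.sin φ₁ := by
      rw [← hxH]; simp [EuclideanSpace.inner_single_right]
    exact mul_left_cancel₀ hR.ne' h
  have hu2 : ∑ j : Fin n, u (Fin.castSucc j) ^ 2 + Real.sin φ₁ ^ 2 = 1 := by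
    have h := EuclideanSpace.real_norm_sq_eq u
    rw [hu, Fin.sum_univ_castSucc, hul] at h
    linarith
  have ha2 : ∑ j : Fin n, a (Fin.castSucc j) ^ 2 + a (Fin.last n) ^ 2 = R ^ 2 := by
    have h := EuclideanSpace.real_norm_sq_eq a
    rw [ha, Fin.sum_univ_castSucc] at h
    linarith
  have hside : 0 ≤ ∑ j : Fin n, u (Fin.castSucc j) * a (Fin.castSucc j)
      + Real.sin φ₁ * a (Fin.last n) := by
    rw [PiLp.inner_apply, Fin.sum_univ_castSucc] at haSide
    simpa [hul, mul_comm] using haSide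
  have hcs := Finset.sum_mul_sq_le_sq_mul_sq Finset.univ
    (fun j : Fin n => u (Fin.castSucc j)) (fun j : Fin n => a (Fin.castSucc j))
  have hf : ⟪u, fContract n R lam a⟫ =
      lam * ∑ j : Fin n, u (Fin.castSucc j) * a (Fin.castSucc j) + Real.sin φ₁ *
        Real.sqrt (R ^ 2 - lam ^ 2 * ∑ j : Fin n, a (Fin.castSucc j) ^ 2) := by
    rw [PiLp.inner_apply, Fin.sum_univ_castSucc, Finset.mul_sum]
    simp [fContract, hul, (Fin.castSucc_lt_last _).ne]
    congr 1
    · exact Finset.sum_congr rfl fun j _ => by ring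
    · ring
  rw [hf]
  have hr0 : 0 ≤ ∑ j : Fin n, a (Fin.castSucc j) ^ 2 := Finset.sum_nonneg fun j _ => sq_nonneg _
  generalize (∑ j : Fin n, u (Fin.castSucc j) * a (Fin.castSucc j)) = p at *
  generalize (∑ j : Fin n, a (Fin.castSucc j) ^ 2) = r at *
  generalize (∑ j : Fin n, u (Fin.castSucc j) ^ 2) = w at *
  generalize a (Fin.last n) = t at *
  generalize Real.sin φ₁ = s at *
  generalize Real.cos φ₁ = c at *
  have hl2 : lam ^ 2 < 1 := by nlinarith
  have hBn : 0 ≤ 1 - (lam * s) ^ 2 := sub_nonneg.2 (pow_le_one₀ hls0.le (by linarith))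
  have hAn : 0 ≤ R ^ 2 - lam ^ 2 * r := by
    have h1 := mul_le_mul_of_nonneg_right hl2.le hr0
    linarith [sq_nonneg t]
  have hA0 := Real.sqrt_nonneg (R ^ 2 - lam ^ 2 * r)
  have hA2 := Real.sq_sqrt hAn
  have hB0 := Real.sqrt_nonneg (1 - (lam * s) ^ 2)
  have hB2 := Real.sq_sqrt hBn
  generalize Real.sqrt (R ^ 2 - lam ^ 2 * r) = A at *
  generalize Real.sqrt (1 - (lam * s) ^ 2) = B at *
  have hw : w = c ^ 2 := by linarith
  subst hw
  rcases le_total t (R * c) with ht | ht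
  · -- use the side condition
    have hAt : lam * t ≤ A := by
      refine (abs_le_of_sq_le_sq' ?_ hA0).2
      have h1 := mul_nonneg (sq_nonneg R) (sub_nonneg.2 hl2.le)
      have hr : r = R ^ 2 - t ^ 2 := by linarith
      rw [hA2, hr]
      linarith
    have hBt : lam * c ≤ B := by
      refine (abs_le_of_sq_le_sq' ?_ hB0).2
      have h2 : s ^ 2 = 1 - c ^ 2 := by linarith
      rw [hB2, mul_pow, mul_pow, h2]
      linarith
    have hBp : 0 < R * B := mul_pos hR (lt_of_lt_of_le (by positivity) hBt)
    have hRB : lam * (R * c) ≤ R * B := by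
      have := mul_le_mul_of_nonneg_left hBt hR.le
      linarith
    have hd : (R * B - A) * (R * B + A) = lam * (R * c - t) * (lam * (R * c + t)) := by
      have e1 : (R * B - A) * (R * B + A) = R ^ 2 * B ^ 2 - A ^ 2 := by ring
      rw [e1, hA2, hB2]
      have : r = R ^ 2 - t ^ 2 := by linarith
      have h2 : s ^ 2 = 1 - c ^ 2 := by linarith
      rw [this, mul_pow, h2]; ring
    have key : R * B - A ≤ lam * (R * c - t) := by
      have hn0 : 0 ≤ lam * (R * c - t) := mul_nonneg hlam0.le (by linarith)
      have : (R * B - A) * (R * B + A) ≤ lam * (R * c - t) * (R * B + A) := by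
        rw [hd]; exact mul_le_mul_of_nonneg_left (by linarith) hn0
      exact le_of_mul_le_mul_right this (by linarith)
    have k2 := mul_le_mul_of_nonneg_left key hs0.le
    have k3 := mul_nonneg hlam0.le hside
    linarith
  · -- use Cauchy-Schwarz
    have hrs : r ≤ (R * s) ^ 2 := by
      have : (R * c) ^ 2 ≤ t ^ 2 := pow_le_pow_left₀ (by positivity) ht 2
      have h2 : s ^ 2 = 1 - c ^ 2 := by linarith
      rw [mul_pow, h2]
      linarith
    have hp : -(R * s * c) ≤ p := by
      refine (abs_le_of_sq_le_sq' ?_ (by positivity)).1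
      have := mul_le_mul_of_nonneg_left hrs (sq_nonneg c)
      linarith
    have hAB : R * B ≤ A := by
      refine (abs_le_of_sq_le_sq' ?_ hA0).2
      have := mul_le_mul_of_nonneg_left hrs (sq_nonneg lam)
      rw [mul_pow, hA2, hB2]
      linarith
    have k2 := mul_le_mul_of_nonneg_left hAB hs0.le
    have k3 := mul_le_mul_of_nonneg_left hp hlam0.le
    linarith
end
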